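/- arXiv:2512.11570 — 6 statements merged into one kernel-verified Lean document; each statement's English description precedes it below -/
import Mathlib

section
/- Under the endpoint Gibbs setup and the trajectory-realization hypothesis, the Lebesgue integral (with values in [0,∞]) over initial conditions satisfies ∫_{Γ₀} exp(−β (H₁*(T(x₀)) − H₀*(T(x₀)))) dP₀(x₀) = exp(−β ΔF*) · (1 + χ²(p₁‖p₀)), where both sides may simultaneously equal ∞. (Trajectory equality, negative-exponent form, Theorem 2.) -/
open MeasureTheory

/-- **Trajectory equality, negative-exponent form (Theorem 2).**
Under the endpoint Gibbs setup and the trajectory-realization hypothesis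
(asymptotic equilibration: the pushforward of `P₀` under the system trajectory
map `T` has density `p₁` with respect to `m`), the Lebesgue integral over
initial conditions of `exp (-β (H₁*(T x₀) - H₀*(T x₀)))` equals
`exp (-β ΔF*) * (1 + χ²(p₁‖p₀))`, where both sides may simultaneously be `∞`. -/
theorem trajectory_equality_neg_exponent
    {Ω : Type*} [MeasurableSpace Ω] (m : Measure Ω) [SigmaFinite m]
    (β : ℝ) (hβ : 0 < β)
    (H0 H1 : Ω → ℝ) (hH0 : Measurable H0) (hH1 : Measurable H1)
    (Z0 Z1 : ℝ)
    (hZ0int : Integrable (fun x => Real.exp (-β * H0 x)) m)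
    (hZ1int : Integrable (fun x => Real.exp (-β * H1 x)) m)
    (hZ0 : Z0 = ∫ x, Real.exp (-β * H0 x) ∂m)
    (hZ1 : Z1 = ∫ x, Real.exp (-β * H1 x) ∂m)
    (hZ0pos : 0 < Z0) (hZ1pos : 0 < Z1)
    (p0 p1 : Ω → ℝ)
    (hp0 : p0 = fun x => Real.exp (-β * H0 x) / Z0)
    (hp1 : p1 = fun x => Real.exp (-β * H1 x) / Z1)
    (ΔF : ℝ) (hΔF : ΔF = -β⁻¹ * Real.log (Z1 / Z0))
    {Γ₀ : Type*} [MeasurableSpace Γ₀] (P₀ : Measure Γ₀) [IsProbabilityMeasure P₀]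
    (T : Γ₀ → Ω) (hT : Measurable T)
    (hpush : Measure.map T P₀ = m.withDensity (fun x => ENNReal.ofReal (p1 x))) :
    ∫⁻ x₀, ENNReal.ofReal (Real.exp (-β * (H1 (T x₀) - H0 (T x₀)))) ∂P₀
      = ENNReal.ofReal (Real.exp (-β * ΔF))
        * ∫⁻ x, ENNReal.ofReal (p1 x ^ 2 / p0 x) ∂m := by
  have hexp : Real.exp (-β * ΔF) = Z1 / Z0 := by
    rw [hΔF, show -β * (-β⁻¹ * Real.log (Z1 / Z0)) = Real.log (Z1 / Z0) by
      field_simp, Real.exp_log (div_pos hZ1pos hZ0pos)]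
  have hp1m : Measurable fun x => ENNReal.ofReal (p1 x) := by
    rw [hp1]; fun_prop
  have hwm : Measurable fun x => ENNReal.ofReal (Real.exp (-β * (H1 x - H0 x))) := by
    fun_prop
  have hrm : Measurable fun x => ENNReal.ofReal (p1 x ^ 2 / p0 x) := by
    rw [hp0, hp1]; fun_prop
  rw [← lintegral_map hwm hT, hpush, lintegral_withDensity_eq_lintegral_mul _ hp1m hwm,
    ← lintegral_const_mul _ hrm]
  refine lintegral_congr fun x => ?_
  have hp1x : 0 ≤ p1 x := by rw [hp1]; positivity
  rw [Pi.mul_apply, ← ENNReal.ofReal_mul hp1x, ← ENNReal.ofReal_mul (Real.exp_nonneg _), hexp,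
    hp0, hp1, show -β * (H1 x - H0 x) = -β * H1 x - -β * H0 x by ring, Real.exp_sub]
  congr 1
  field_simp
end

section
/- Under the endpoint Gibbs setup and the trajectory-realization hypothesis, ∫_{Γ₀} exp(+β (H₁*(T(x₀)) − H₀*(T(x₀)))) dP₀(x₀) = exp(+β ΔF*); in particular the left-hand side is finite. (Trajectory equality, positive-exponent form, Theorem 2.) -/
open MeasureTheory

/-- **Trajectory equality, positive-exponent form (Theorem 2).**
Under the endpoint Gibbs setup and the trajectory-realization hypothesis,
`∫ exp (+β (H₁*(T x₀) - H₀*(T x₀))) dP₀ = exp (+β ΔF*)`; in particular the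
left-hand side is finite (it equals an `ENNReal.ofReal`, hence is `< ∞`). -/
theorem trajectory_equality_pos_exponent
    {Ω : Type*} [MeasurableSpace Ω] (m : Measure Ω) [SigmaFinite m]
    (β : ℝ) (hβ : 0 < β)
    (H0 H1 : Ω → ℝ) (hH0 : Measurable H0) (hH1 : Measurable H1)
    (Z0 Z1 : ℝ)
    (hZ0int : Integrable (fun x => Real.exp (-β * H0 x)) m)
    (hZ1int : Integrable (fun x => Real.exp (-β * H1 x)) m)
    (hZ0 : Z0 = ∫ x, Real.exp (-β * H0 x) ∂m)
    (hZ1 : Z1 = ∫ x, Real.exp (-β * H1 x) ∂m)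
    (hZ0pos : 0 < Z0) (hZ1pos : 0 < Z1)
    (p0 p1 : Ω → ℝ)
    (hp0 : p0 = fun x => Real.exp (-β * H0 x) / Z0)
    (hp1 : p1 = fun x => Real.exp (-β * H1 x) / Z1)
    (ΔF : ℝ) (hΔF : ΔF = -β⁻¹ * Real.log (Z1 / Z0))
    {Γ₀ : Type*} [MeasurableSpace Γ₀] (P₀ : Measure Γ₀) [IsProbabilityMeasure P₀]
    (T : Γ₀ → Ω) (hT : Measurable T)
    (hpush : Measure.map T P₀ = m.withDensity (fun x => ENNReal.ofReal (p1 x))) :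
    ∫⁻ x₀, ENNReal.ofReal (Real.exp (β * (H1 (T x₀) - H0 (T x₀)))) ∂P₀
      = ENNReal.ofReal (Real.exp (β * ΔF)) := by
  have hmeas : Measurable fun x => ENNReal.ofReal (Real.exp (β * (H1 x - H0 x))) := by fun_prop
  have hp1meas : Measurable fun x => ENNReal.ofReal (p1 x) := by
    rw [hp1]
    fun_prop
  have hprod (x : Ω) : ENNReal.ofReal (p1 x) * ENNReal.ofReal (Real.exp (β * (H1 x - H0 x)))
      = ENNReal.ofReal (Real.exp (-β * H0 x) / Z1) := by
    have hexp : Real.exp (-β * H0 x)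
        = Real.exp (-β * H1 x) * Real.exp (β * (H1 x - H0 x)) := by
      rw [← Real.exp_add]
      ring_nf
    rw [← ENNReal.ofReal_mul' (Real.exp_pos _).le, hp1, hexp]
    ring_nf
  have hfree : Real.exp (β * ΔF) = Z0 / Z1 := by
    have hexponent : β * ΔF = -Real.log (Z1 / Z0) := by
      rw [hΔF]
      field_simp
    rw [hexponent, Real.exp_neg, Real.exp_log (div_pos hZ1pos hZ0pos), inv_div]
  rw [← lintegral_map hmeas hT, hpush, lintegral_withDensity_eq_lintegral_mul _ hp1meas hmeas]
  simp only [Pi.mul_apply, hprod]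
  rw [← ofReal_integral_eq_lintegral_ofReal (hZ0int.div_const Z1)
    (.of_forall fun x => (div_pos (Real.exp_pos _) hZ1pos).le), integral_div, ← hZ0, hfree]
end

section
/- Assume the smooth endpoint setup on ℝⁿ and the pathwise trajectory hypothesis. Then the Lebesgue integral (with values in [0,∞]) over initial conditions satisfies ∫_{Γ₀} exp(−β [W*(x₀) + Q*(x₀) − II*(x₀)]) dP₀(x₀) = exp(−β ΔF*) · (1 + χ²(p₁‖p₀)), where both sides may simultaneously equal ∞. (Heat–work–feedback representation of the endpoint equality, negative-exponent form, Eq. (45).) -/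
open MeasureTheory Set

/-- Fundamental theorem of calculus for a `C¹` function along a `C¹` path. -/
theorem integral_fderiv_along_path {E : Type*} [NormedAddCommGroup E] [NormedSpace ℝ E]
    {f : E → ℝ} (hf : ContDiff ℝ 1 f) {a b : ℝ} (hab : a ≤ b) {γ γ' : ℝ → E}
    (hγ : ∀ t ∈ Icc a b, HasDerivWithinAt γ (γ' t) (Icc a b) t)
    (hγ' : ContinuousOn γ' (Icc a b)) :
    ∫ t in a..b, fderiv ℝ f (γ t) (γ' t) = f (γ b) - f (γ a) := by
  have hγc : ContinuousOn γ (Icc a b) := fun t ht => (hγ t ht).continuousWithinAt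
  refine intervalIntegral.integral_eq_sub_of_hasDerivAt_of_le hab
    (hf.continuous.comp_continuousOn hγc) (fun t ht => ?_) ?_
  · exact ((hf.differentiable one_ne_zero) (γ t)).hasFDerivAt.comp_hasDerivAt t
      ((hγ t (Ioo_subset_Icc_self ht)).hasDerivAt (Icc_mem_nhds ht.1 ht.2))
  · refine ContinuousOn.intervalIntegrable_of_Icc hab ?_
    exact ((hf.continuous_fderiv one_ne_zero).comp_continuousOn hγc).clm_apply hγ'

/-- **Heat–work–feedback representation of the endpoint equality,
negative-exponent form (Eq. (45)).**
Under the smooth endpoint setup on `ℝⁿ` (Gibbs endpoints of a `C¹` HMF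
`H* : ℝⁿ × ℝ × ℝ → ℝ` with respect to Lebesgue measure) and the pathwise
trajectory hypothesis (a family of `C¹` trajectories whose endpoint map
pushes `P₀` forward to the density `p₁`), the Lebesgue integral of
`exp (-β [W* + Q* - II*])` over initial conditions equals
`exp (-β ΔF*) * (1 + χ²(p₁‖p₀))`, where both sides may simultaneously be `∞`. -/
theorem heat_work_feedback_endpoint_equality_neg
    (n : ℕ) (hn : 1 ≤ n)
    (β : ℝ) (hβ : 0 < β)
    (teq : ℝ) (hteq : 0 < teq)
    (Hstar : EuclideanSpace ℝ (Fin n) × ℝ × ℝ → ℝ)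
    (hHstar : ContDiff ℝ 1 Hstar)
    (lam lam' C C' : ℝ → ℝ)
    (hlam : ∀ t ∈ Icc (0:ℝ) teq, HasDerivWithinAt lam (lam' t) (Icc (0:ℝ) teq) t)
    (hlam' : ContinuousOn lam' (Icc (0:ℝ) teq))
    (hC : ∀ t ∈ Icc (0:ℝ) teq, HasDerivWithinAt C (C' t) (Icc (0:ℝ) teq) t)
    (hC' : ContinuousOn C' (Icc (0:ℝ) teq))
    (H0 H1 : EuclideanSpace ℝ (Fin n) → ℝ)
    (hH0 : H0 = fun x => Hstar (x, lam 0, C 0))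
    (hH1 : H1 = fun x => Hstar (x, lam teq, C teq))
    (Z0 Z1 : ℝ)
    (hZ0int : Integrable (fun x => Real.exp (-β * H0 x)) volume)
    (hZ1int : Integrable (fun x => Real.exp (-β * H1 x)) volume)
    (hZ0 : Z0 = ∫ x, Real.exp (-β * H0 x))
    (hZ1 : Z1 = ∫ x, Real.exp (-β * H1 x))
    (hZ0pos : 0 < Z0) (hZ1pos : 0 < Z1)
    (p0 p1 : EuclideanSpace ℝ (Fin n) → ℝ)
    (hp0 : p0 = fun x => Real.exp (-β * H0 x) / Z0)
    (hp1 : p1 = fun x => Real.exp (-β * H1 x) / Z1)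
    (ΔF : ℝ) (hΔF : ΔF = -β⁻¹ * Real.log (Z1 / Z0))
    {Γ₀ : Type*} [MeasurableSpace Γ₀] (P₀ : Measure Γ₀) [IsProbabilityMeasure P₀]
    (X : Γ₀ → ℝ → EuclideanSpace ℝ (Fin n))
    (X' : Γ₀ → ℝ → EuclideanSpace ℝ (Fin n))
    (hX : ∀ x₀, ∀ t ∈ Icc (0:ℝ) teq,
      HasDerivWithinAt (X x₀) (X' x₀ t) (Icc (0:ℝ) teq) t)
    (hX' : ∀ x₀, ContinuousOn (X' x₀) (Icc (0:ℝ) teq))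
    (T : Γ₀ → EuclideanSpace ℝ (Fin n))
    (hTdef : T = fun x₀ => X x₀ teq)
    (hT : Measurable T)
    (hpush : Measure.map T P₀
      = (volume : Measure (EuclideanSpace ℝ (Fin n))).withDensity
          (fun x => ENNReal.ofReal (p1 x)))
    (W Q II : Γ₀ → ℝ)
    (hW : W = fun x₀ => ∫ t in (0:ℝ)..teq,
      (fderiv ℝ Hstar (X x₀ t, lam t, C t)) (0, lam' t, 0)
        + (fderiv ℝ Hstar (X x₀ t, lam t, C t)) (0, 0, C' t))
    (hQ : Q = fun x₀ => ∫ t in (0:ℝ)..teq,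
      (fderiv ℝ Hstar (X x₀ t, lam t, C t)) (X' x₀ t, 0, 0))
    (hII : II = fun x₀ => ∫ t in (0:ℝ)..teq,
      (fderiv ℝ (fun z => Hstar (z, lam 0, C 0)) (X x₀ t)) (X' x₀ t))
    (hWmeas : Measurable W) (hQmeas : Measurable Q) (hIImeas : Measurable II) :
    ∫⁻ x₀, ENNReal.ofReal (Real.exp (-β * (W x₀ + Q x₀ - II x₀))) ∂P₀
      = ENNReal.ofReal (Real.exp (-β * ΔF))
        * ∫⁻ x, ENNReal.ofReal (p1 x ^ 2 / p0 x) := by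
  have hXc (x₀) : ContinuousOn (X x₀) (Icc 0 teq) :=
    fun t ht => (hX x₀ t ht).continuousWithinAt
  have hlamc : ContinuousOn lam (Icc 0 teq) := fun t ht => (hlam t ht).continuousWithinAt
  have hCc : ContinuousOn C (Icc 0 teq) := fun t ht => (hC t ht).continuousWithinAt
  have hH0C : ContDiff ℝ 1 H0 := by
    rw [hH0]; exact hHstar.comp (by fun_prop)
  have hH1C : ContDiff ℝ 1 H1 := by
    rw [hH1]; exact hHstar.comp (by fun_prop)
  have hDc (x₀) : ContinuousOn (fun t => fderiv ℝ Hstar (X x₀ t, lam t, C t)) (Icc 0 teq) :=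
    (hHstar.continuous_fderiv one_ne_zero).comp_continuousOn
      ((hXc x₀).prodMk (hlamc.prodMk hCc))
  have hWQ (x₀) : W x₀ + Q x₀ = H1 (X x₀ teq) - H0 (X x₀ 0) := by
    have key := integral_fderiv_along_path hHstar hteq.le
      (γ := fun t => (X x₀ t, lam t, C t)) (γ' := fun t => (X' x₀ t, lam' t, C' t))
      (fun t ht => (hX x₀ t ht).prodMk ((hlam t ht).prodMk (hC t ht)))
      ((hX' x₀).prodMk (hlam'.prodMk hC'))
    rw [hW, hQ, hH0, hH1]
    dsimp only
    rw [← key, ← intervalIntegral.integral_add]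
    · congr 1 with t
      rw [← map_add, ← map_add]
      simp
    · refine ContinuousOn.intervalIntegrable_of_Icc hteq.le (ContinuousOn.add ?_ ?_)
      · exact (hDc x₀).clm_apply
          (continuousOn_const.prodMk (hlam'.prodMk continuousOn_const))
      · exact (hDc x₀).clm_apply
          (continuousOn_const.prodMk (continuousOn_const.prodMk hC'))
    · refine ContinuousOn.intervalIntegrable_of_Icc hteq.le ?_
      exact (hDc x₀).clm_apply ((hX' x₀).prodMk continuousOn_const)
  have hIIeq (x₀) : II x₀ = H0 (X x₀ teq) - H0 (X x₀ 0) := by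
    rw [← integral_fderiv_along_path hH0C hteq.le (hX x₀) (hX' x₀), hII, hH0]
  have hWork (x₀) : W x₀ + Q x₀ - II x₀ = H1 (T x₀) - H0 (T x₀) := by
    rw [hWQ, hIIeq, hTdef]; ring
  have hH0m : Measurable H0 := hH0C.continuous.measurable
  have hH1m : Measurable H1 := hH1C.continuous.measurable
  have hp0m : Measurable p0 := by rw [hp0]; fun_prop
  have hp1m : Measurable p1 := by rw [hp1]; fun_prop
  have hgm : Measurable fun x => ENNReal.ofReal (Real.exp (-β * (H1 x - H0 x))) := by
    fun_prop
  have hexpΔF : Real.exp (-β * ΔF) = Z1 / Z0 := by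
    rw [hΔF, show -β * (-β⁻¹ * Real.log (Z1 / Z0)) = Real.log (Z1 / Z0) by field_simp,
      Real.exp_log (div_pos hZ1pos hZ0pos)]
  simp_rw [hWork]
  rw [← lintegral_map hgm hT, hpush, lintegral_withDensity_eq_lintegral_mul _ (by fun_prop) hgm,
    ← lintegral_const_mul _ (by fun_prop)]
  refine lintegral_congr fun x => ?_
  have hp1nn : 0 ≤ p1 x := by rw [hp1]; positivity
  rw [Pi.mul_apply, ← ENNReal.ofReal_mul hp1nn, ← ENNReal.ofReal_mul (Real.exp_pos _).le, hexpΔF]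
  congr 1
  rw [show -β * (H1 x - H0 x) = -β * H1 x - -β * H0 x by ring, Real.exp_sub, hp0, hp1]
  field_simp
end

section
/- Under the frozen-driving Gibbs setup, the Lebesgue integral (with values in [0,∞]) satisfies ∫_Ω (M₁(x)/M₀(x)) · p₁(x) d𝔪(x) = exp(−β ΔF*) · (1 + χ²(p₁‖p₀)), where both sides may simultaneously equal ∞. (Frozen-driving endpoint equality, negative-exponent form, Corollary 5, Eq. (50).) -/
open MeasureTheory

/-- The Boltzmann weight of a Hamiltonian of mean force factors as the bare weight times the
environment functional. -/
theorem exp_neg_mul_sub_inv_mul_log {β : ℝ} (hβ : β ≠ 0) (h : ℝ) {M : ℝ} (hM : 0 < M) :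
    Real.exp (-β * (h - β⁻¹ * Real.log M)) = Real.exp (-β * h) * M := by
  have key : -β * (h - β⁻¹ * Real.log M) = -β * h + Real.log M := by
    field_simp
    ring
  rw [key, Real.exp_add, Real.exp_log hM]

/-- **Frozen-driving endpoint equality, negative-exponent form
(Corollary 5, Eq. (50)).**
Under the frozen-driving Gibbs setup (HMFs `Hᵢ* = H_S - β⁻¹ log Mᵢ` built from
the environment-interaction functionals `M₀, M₁`), the Lebesgue integral of
`(M₁/M₀) · p₁` equals `exp (-β ΔF*) * (1 + χ²(p₁‖p₀))`, where both sides may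
simultaneously be `∞`. -/
theorem frozen_driving_endpoint_equality_neg
    {Ω : Type*} [MeasurableSpace Ω] (m : Measure Ω) [SigmaFinite m]
    (β : ℝ) (hβ : 0 < β)
    (HS : Ω → ℝ) (hHS : Measurable HS)
    (M0 M1 : Ω → ℝ) (hM0 : Measurable M0) (hM1 : Measurable M1)
    (hM0pos : ∀ x, 0 < M0 x) (hM1pos : ∀ x, 0 < M1 x)
    (H0 H1 : Ω → ℝ)
    (hH0 : H0 = fun x => HS x - β⁻¹ * Real.log (M0 x))
    (hH1 : H1 = fun x => HS x - β⁻¹ * Real.log (M1 x))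
    (Z0 Z1 : ℝ)
    (hZ0int : Integrable (fun x => Real.exp (-β * H0 x)) m)
    (hZ1int : Integrable (fun x => Real.exp (-β * H1 x)) m)
    (hZ0 : Z0 = ∫ x, Real.exp (-β * H0 x) ∂m)
    (hZ1 : Z1 = ∫ x, Real.exp (-β * H1 x) ∂m)
    (hZ0pos : 0 < Z0) (hZ1pos : 0 < Z1)
    (p0 p1 : Ω → ℝ)
    (hp0 : p0 = fun x => Real.exp (-β * H0 x) / Z0)
    (hp1 : p1 = fun x => Real.exp (-β * H1 x) / Z1)
    (ΔF : ℝ) (hΔF : ΔF = -β⁻¹ * Real.log (Z1 / Z0)) :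
    ∫⁻ x, ENNReal.ofReal (M1 x / M0 x * p1 x) ∂m
      = ENNReal.ofReal (Real.exp (-β * ΔF))
        * ∫⁻ x, ENNReal.ofReal (p1 x ^ 2 / p0 x) ∂m := by
  have hexp : Real.exp (-β * ΔF) = Z1 / Z0 := by
    rw [hΔF, show -β * (-β⁻¹ * Real.log (Z1 / Z0)) = Real.log (Z1 / Z0) by field_simp,
      Real.exp_log (div_pos hZ1pos hZ0pos)]
  rw [← lintegral_const_mul' _ _ ENNReal.ofReal_ne_top]
  refine lintegral_congr fun x => ?_
  rw [← ENNReal.ofReal_mul (Real.exp_pos _).le, hexp]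
  congr 1
  have h0 := hM0pos x
  have he := Real.exp_pos (-β * HS x)
  simp only [hp0, hp1, hH0, hH1, exp_neg_mul_sub_inv_mul_log hβ.ne' _ (hM0pos x),
    exp_neg_mul_sub_inv_mul_log hβ.ne' _ (hM1pos x)]
  generalize Real.exp (-β * HS x) = e at he ⊢
  field_simp
end

section
/- Under the frozen-driving Gibbs setup and the trajectory-realization hypothesis, ∫_{Γ₀} (M₀(T(x₀))/M₁(T(x₀))) dP₀(x₀) = exp(+β ΔF*); in particular the left-hand side is finite. (Frozen-driving trajectory equality, positive-exponent form, Corollary 6, Eq. (54).) -/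
open MeasureTheory

/-- The Boltzmann factor of a Hamiltonian of mean force is the bare Boltzmann factor times
the interaction functional. -/
theorem exp_neg_mul_meanForce {β M : ℝ} (hβ : β ≠ 0) (hM : 0 < M) (h : ℝ) :
    Real.exp (-β * (h - β⁻¹ * Real.log M)) = Real.exp (-β * h) * M := by
  have hexp : -β * (h - β⁻¹ * Real.log M) = -β * h + Real.log M := by
    field_simp
    ring
  rw [hexp, Real.exp_add, Real.exp_log hM]

/-- The exponential of a free energy difference is the inverse ratio of partition functions. -/
theorem exp_mul_freeEnergy_diff {β Z₀ Z₁ : ℝ} (hβ : β ≠ 0) (hZ₀ : 0 < Z₀) (hZ₁ : 0 < Z₁) :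
    Real.exp (β * (-β⁻¹ * Real.log (Z₁ / Z₀))) = Z₀ / Z₁ := by
  have hexp : β * (-β⁻¹ * Real.log (Z₁ / Z₀)) = -Real.log (Z₁ / Z₀) := by
    field_simp
  rw [hexp, Real.exp_neg, Real.exp_log (div_pos hZ₁ hZ₀), inv_div]

/-- **Frozen-driving trajectory equality, positive-exponent form
(Corollary 6, Eq. (54)).**
Under the frozen-driving Gibbs setup and the trajectory-realization hypothesis,
the Lebesgue integral over initial conditions of `M₀(T x₀) / M₁(T x₀)` equals
`exp (+β ΔF*)`; in particular the left-hand side is finite. -/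
theorem frozen_driving_trajectory_equality_pos
    {Ω : Type*} [MeasurableSpace Ω] (m : Measure Ω) [SigmaFinite m]
    (β : ℝ) (hβ : 0 < β)
    (HS : Ω → ℝ) (hHS : Measurable HS)
    (M0 M1 : Ω → ℝ) (hM0 : Measurable M0) (hM1 : Measurable M1)
    (hM0pos : ∀ x, 0 < M0 x) (hM1pos : ∀ x, 0 < M1 x)
    (H0 H1 : Ω → ℝ)
    (hH0 : H0 = fun x => HS x - β⁻¹ * Real.log (M0 x))
    (hH1 : H1 = fun x => HS x - β⁻¹ * Real.log (M1 x))
    (Z0 Z1 : ℝ)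
    (hZ0int : Integrable (fun x => Real.exp (-β * H0 x)) m)
    (hZ1int : Integrable (fun x => Real.exp (-β * H1 x)) m)
    (hZ0 : Z0 = ∫ x, Real.exp (-β * H0 x) ∂m)
    (hZ1 : Z1 = ∫ x, Real.exp (-β * H1 x) ∂m)
    (hZ0pos : 0 < Z0) (hZ1pos : 0 < Z1)
    (p0 p1 : Ω → ℝ)
    (hp0 : p0 = fun x => Real.exp (-β * H0 x) / Z0)
    (hp1 : p1 = fun x => Real.exp (-β * H1 x) / Z1)
    (ΔF : ℝ) (hΔF : ΔF = -β⁻¹ * Real.log (Z1 / Z0))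
    {Γ₀ : Type*} [MeasurableSpace Γ₀] (P₀ : Measure Γ₀) [IsProbabilityMeasure P₀]
    (T : Γ₀ → Ω) (hT : Measurable T)
    (hpush : Measure.map T P₀ = m.withDensity (fun x => ENNReal.ofReal (p1 x))) :
    ∫⁻ x₀, ENNReal.ofReal (M0 (T x₀) / M1 (T x₀)) ∂P₀
      = ENNReal.ofReal (Real.exp (β * ΔF)) := by
  have hratio : Measurable fun x => ENNReal.ofReal (M0 x / M1 x) := (hM0.div hM1).ennreal_ofReal
  have hp1meas : Measurable fun x => ENNReal.ofReal (p1 x) := by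
    subst hp1 hH1
    fun_prop
  have hdensity : ∀ x, p1 x * (M0 x / M1 x) = Real.exp (-β * H0 x) / Z1 := by
    intro x
    have hM1x := (hM1pos x).ne'
    simp only [hp1, hH0, hH1, exp_neg_mul_meanForce hβ.ne' (hM0pos x),
      exp_neg_mul_meanForce hβ.ne' (hM1pos x)]
    field_simp
  have hp1nonneg : ∀ x, 0 ≤ p1 x := by
    intro x
    rw [hp1]
    positivity
  calc ∫⁻ x₀, ENNReal.ofReal (M0 (T x₀) / M1 (T x₀)) ∂P₀
      = ∫⁻ x, ENNReal.ofReal (M0 x / M1 x) ∂(Measure.map T P₀) := (lintegral_map hratio hT).symm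
    _ = ∫⁻ x, ENNReal.ofReal (p1 x) * ENNReal.ofReal (M0 x / M1 x) ∂m := by
        rw [hpush, lintegral_withDensity_eq_lintegral_mul _ hp1meas hratio]
        rfl
    _ = ∫⁻ x, ENNReal.ofReal (Real.exp (-β * H0 x) / Z1) ∂m := by
        simp only [← ENNReal.ofReal_mul (hp1nonneg _), hdensity]
    _ = ENNReal.ofReal (∫ x, Real.exp (-β * H0 x) / Z1 ∂m) :=
        (ofReal_integral_eq_lintegral_ofReal (hZ0int.div_const Z1)
          (ae_of_all _ fun x => by positivity)).symm
    _ = ENNReal.ofReal (Real.exp (β * ΔF)) := by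
        rw [integral_div, ← hZ0, hΔF, exp_mul_freeEnergy_diff hβ.ne' hZ0pos hZ1pos]
end

section
/- Under the uncoupled-reference composite setup, the Hamiltonian-of-mean-force free energy difference satisfies exp(−β ΔF*_S) = ∫_{Ω_S × Ω_E} exp(−β V(x,y)) dP₀(x,y), where P₀ is the product Gibbs probability measure with density exp(−β (H_S(x) + H_E(y)))/(Z_S · Z_E) relative to μ_S ⊗ μ_E. (Zwanzig FEP in the HMF language, Eq. (79).) -/
open MeasureTheory

/-- **Zwanzig FEP in the HMF language (Eq. (79)).**
Under the uncoupled-reference composite setup (initial endpoint the uncoupled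
composite with HMF `H₀* = H_S`, final endpoint with HMF
`H₁* = H_S - β⁻¹ log M`), the Hamiltonian-of-mean-force free energy difference
satisfies `exp (-β ΔF*_S) = ∫ exp (-β V) dP₀`, where `P₀` is the product Gibbs
probability measure with density `exp (-β (H_S + H_E))/(Z_S Z_E)` relative to
`μ_S ⊗ μ_E`. -/
theorem zwanzig_fep_hmf_language
    {Ω_S Ω_E : Type*} [MeasurableSpace Ω_S] [MeasurableSpace Ω_E]
    (μS : Measure Ω_S) (μE : Measure Ω_E) [SigmaFinite μS] [SigmaFinite μE]
    (β : ℝ) (hβ : 0 < β)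
    (HS : Ω_S → ℝ) (HE : Ω_E → ℝ) (V : Ω_S × Ω_E → ℝ)
    (hHS : Measurable HS) (hHE : Measurable HE) (hV : Measurable V)
    (ZS ZE : ℝ)
    (hZSint : Integrable (fun x => Real.exp (-β * HS x)) μS)
    (hZEint : Integrable (fun y => Real.exp (-β * HE y)) μE)
    (hZS : ZS = ∫ x, Real.exp (-β * HS x) ∂μS)
    (hZE : ZE = ∫ y, Real.exp (-β * HE y) ∂μE)
    (hZSpos : 0 < ZS) (hZEpos : 0 < ZE)
    (M : Ω_S → ℝ)
    (hMint : ∀ x, Integrable (fun y => Real.exp (-β * (HE y + V (x, y)))) μE)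
    (hM : M = fun x => ZE⁻¹ * ∫ y, Real.exp (-β * (HE y + V (x, y))) ∂μE)
    (hMpos : ∀ x, 0 < M x)
    (Hstar1 : Ω_S → ℝ)
    (hHstar1 : Hstar1 = fun x => HS x - β⁻¹ * Real.log (M x))
    (Z1s : ℝ)
    (hZ1sint : Integrable (fun x => Real.exp (-β * Hstar1 x)) μS)
    (hZ1s : Z1s = ∫ x, Real.exp (-β * Hstar1 x) ∂μS)
    (hZ1spos : 0 < Z1s)
    (ΔF : ℝ) (hΔF : ΔF = -β⁻¹ * Real.log (Z1s / ZS))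
    (P₀ : Measure (Ω_S × Ω_E))
    (hP₀ : P₀ = (μS.prod μE).withDensity
      (fun z => ENNReal.ofReal
        (Real.exp (-β * (HS z.1 + HE z.2)) / (ZS * ZE)))) :
    Real.exp (-β * ΔF) = ∫ z, Real.exp (-β * V z) ∂P₀ := by
  have h_fiber (x : Ω_S) :
      ∫ y, Real.exp (-β * HS x) * Real.exp (-β * (HE y + V (x, y))) ∂μE
        = ZE * Real.exp (-β * Hstar1 x) := by
    have hexp : Real.exp (-β * Hstar1 x) = Real.exp (-β * HS x) * M x := by
      have hsplit : -β * Hstar1 x = -β * HS x + Real.log (M x) := by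
        rw [hHstar1]
        field_simp
        ring
      rw [hsplit, Real.exp_add, Real.exp_log (hMpos x)]
    rw [hexp, hM, integral_const_mul]
    field_simp
  have h_int : Integrable (fun z : Ω_S × Ω_E =>
      Real.exp (-β * HS z.1) * Real.exp (-β * (HE z.2 + V z))) (μS.prod μE) := by
    rw [integrable_prod_iff (Measurable.aestronglyMeasurable (by fun_prop))]
    refine ⟨.of_forall fun x => (hMint x).const_mul (Real.exp (-β * HS x)), ?_⟩
    simpa only [norm_mul, Real.norm_eq_abs, Real.abs_exp, h_fiber] using hZ1sint.const_mul ZE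
  have h_total : ∫ z : Ω_S × Ω_E,
      Real.exp (-β * HS z.1) * Real.exp (-β * (HE z.2 + V z)) ∂(μS.prod μE) = ZE * Z1s := by
    rw [integral_prod _ h_int]
    simp only [h_fiber]
    rw [integral_const_mul, hZ1s]
  have h_lhs : Real.exp (-β * ΔF) = Z1s / ZS := by
    have hlog : -β * ΔF = Real.log (Z1s / ZS) := by
      rw [hΔF]
      field_simp
    rw [hlog, Real.exp_log (div_pos hZ1spos hZSpos)]
  rw [h_lhs, hP₀, integral_withDensity_eq_integral_toReal_smul (by fun_prop)
    (.of_forall fun _ => ENNReal.ofReal_lt_top)]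
  have h_integrand (z : Ω_S × Ω_E) :
      (ENNReal.ofReal (Real.exp (-β * (HS z.1 + HE z.2)) / (ZS * ZE))).toReal
          • Real.exp (-β * V z)
        = (ZS * ZE)⁻¹ * (Real.exp (-β * HS z.1) * Real.exp (-β * (HE z.2 + V z))) := by
    rw [ENNReal.toReal_ofReal (by positivity), smul_eq_mul, div_mul_eq_mul_div,
      ← Real.exp_add, ← Real.exp_add, div_eq_inv_mul]
    ring_nf
  simp only [h_integrand]
  rw [integral_const_mul, h_total]
  field_simp
end
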